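/- arXiv:2411.10785 — 6 statements merged into one kernel-verified Lean document; each statement's English description precedes it below -/
import Mathlib

section
/- Let Y be a nonnegative integrable random variable on a probability space and let w > 0. Then E[min{1, Y/w}] ≤ 2·E[Y]/(w + E[Y]). -/
open MeasureTheory

theorem min_one_div_le_two_mul_div_add {m w : ℝ} (hm : 0 ≤ m) (hw : 0 < w) :
    min 1 (m / w) ≤ 2 * m / (w + m) := by
  rcases le_total m w with h | h
  · refine (min_le_right _ _).trans ?_
    rw [div_le_div_iff₀ hw (by positivity)]
    nlinarith [mul_nonneg hm (sub_nonneg.2 h)]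
  · refine (min_le_left _ _).trans ?_
    rw [le_div_iff₀ (by positivity)]
    linarith

theorem integral_min_const_le {Ω : Type*} [MeasurableSpace Ω] {μ : Measure Ω}
    [IsProbabilityMeasure μ] {f : Ω → ℝ} (hf : Integrable f μ) (c : ℝ) :
    ∫ ω, min c (f ω) ∂μ ≤ min c (∫ ω, f ω ∂μ) := by
  have hmin : Integrable (fun ω => min c (f ω)) μ := (integrable_const c).inf hf
  refine le_min ?_ (integral_mono hmin hf fun ω => min_le_right _ _)
  simpa using integral_mono hmin (integrable_const c) fun ω => min_le_left _ _

/-- Proposition 4 of the paper, abstract form. Let `Y` be a nonnegative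
integrable random variable on a probability space and let `w > 0`. Then
`E[min{1, Y/w}] ≤ 2 E[Y] / (w + E[Y])`. -/
theorem expectation_min_one_div_le
    {Ω : Type*} [MeasurableSpace Ω] (ℙ : Measure Ω) [IsProbabilityMeasure ℙ]
    (Y : Ω → ℝ) (hY0 : ∀ ω, 0 ≤ Y ω) (hYint : Integrable Y ℙ)
    (w : ℝ) (hw : 0 < w) :
    ∫ ω, min 1 (Y ω / w) ∂ℙ ≤ 2 * (∫ ω, Y ω ∂ℙ) / (w + ∫ ω, Y ω ∂ℙ) := by
  refine (integral_min_const_le (hYint.div_const w) 1).trans ?_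
  rw [integral_div]
  exact min_one_div_le_two_mul_div_add (integral_nonneg hY0) hw
end

section
/- The function (θ, w, θ', w') ↦ π(θ)·w q̃_θ(w)·q(θ'|θ)·q̃_{θ'}(w')·min{1, (π(θ')q(θ|θ')w')/(π(θ)q(θ'|θ)w)} is symmetric under the swap (θ,w) ↔ (θ',w'), for all points where π(θ)q(θ'|θ)w > 0 and π(θ')q(θ|θ')w' > 0. Consequently the pseudo-marginal Metropolis–Hastings kernel satisfies detailed balance with respect to the density π(θ)·w q̃_θ(w). -/
open MeasureTheory

/-- The Metropolis–Hastings acceptance identity. -/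
theorem mul_min_one_div {a : ℝ} (b : ℝ) (ha : 0 < a) : a * min 1 (b / a) = min a b := by
  rw [mul_min_of_nonneg _ _ ha.le, mul_one, mul_div_cancel₀ _ ha.ne']

/-- equation (4) of the paper. The function
`(θ,w,θ',w') ↦ π(θ)·w q̃_θ(w)·q(θ'|θ)·q̃_{θ'}(w')·min{1, (π(θ')q(θ|θ')w')/(π(θ)q(θ'|θ)w)}`
is symmetric under the swap `(θ,w) ↔ (θ',w')` at all points where
`π(θ)q(θ'|θ)w > 0` and `π(θ')q(θ|θ')w' > 0`; this is the detailed-balance identity of the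
pseudo-marginal Metropolis–Hastings kernel with respect to the density `π(θ)·w q̃_θ(w)`.
Here `prop θ θ'` denotes the proposal density `q(θ'|θ)` and `qt θ w` the noise proposal
density `q̃_θ(w)`. -/
theorem pseudo_marginal_detailed_balance
    {Θ : Type*} (pd : Θ → ℝ) (prop : Θ → Θ → ℝ) (qt : Θ → ℝ → ℝ) :
    ∀ (θ : Θ) (w : ℝ) (θ' : Θ) (w' : ℝ),
      0 < pd θ * prop θ θ' * w → 0 < pd θ' * prop θ' θ * w' →
      pd θ * (w * qt θ w) * prop θ θ' * qt θ' w' *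
          min 1 (pd θ' * prop θ' θ * w' / (pd θ * prop θ θ' * w))
        = pd θ' * (w' * qt θ' w') * prop θ' θ * qt θ w *
          min 1 (pd θ * prop θ θ' * w / (pd θ' * prop θ' θ * w')) := by
  intro θ w θ' w' ha hb
  have h : pd θ * prop θ θ' * w * min 1 (pd θ' * prop θ' θ * w' / (pd θ * prop θ θ' * w))
      = pd θ' * prop θ' θ * w' * min 1 (pd θ * prop θ θ' * w / (pd θ' * prop θ' θ * w')) := by
    rw [mul_min_one_div _ ha, mul_min_one_div _ hb, min_comm]
  linear_combination qt θ w * qt θ' w' * h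
end

section
/- Let σ > 0 and let Z, Z' be independent standard normal random variables. Set W = exp(−σ²/2 + σZ) and W' = exp(−σ²/2 + σZ'). Then E[W·W'·max{W, W'}] = 2·exp(σ²)·Φ(σ/√2), where Φ is the cumulative distribution function of the standard normal distribution. -/
open MeasureTheory ProbabilityTheory Real

lemma gaussianReal_withDensity_exp (t : ℝ) :
    (gaussianReal 0 1).withDensity (fun x ↦ ENNReal.ofReal (exp (t * x - t ^ 2 / 2)))
      = gaussianReal t 1 := by
  rw [gaussianReal_of_var_ne_zero 0 one_ne_zero, gaussianReal_of_var_ne_zero t one_ne_zero,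
    ← withDensity_mul _ (measurable_gaussianPDF 0 1) (by fun_prop)]
  congr 1
  ext x
  rw [Pi.mul_apply, gaussianPDF, gaussianPDF, ← ENNReal.ofReal_mul (gaussianPDFReal_nonneg 0 1 x),
    gaussianPDFReal, gaussianPDFReal, mul_assoc, ← exp_add]
  congr 3
  simp only [NNReal.coe_one]
  ring

lemma integral_exp_mul_exp_mul_gaussianReal_prod (a b : ℝ) (f : ℝ × ℝ → ℝ) :
    ∫ p, exp (a * p.1) * exp (b * p.2) * f p ∂(gaussianReal 0 1).prod (gaussianReal 0 1)
      = exp ((a ^ 2 + b ^ 2) / 2) * ∫ p, f p ∂(gaussianReal a 1).prod (gaussianReal b 1) := by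
  rw [← gaussianReal_withDensity_exp a, ← gaussianReal_withDensity_exp b,
    prod_withDensity (by fun_prop) (by fun_prop),
    integral_withDensity_eq_integral_toReal_smul (by fun_prop)
      (.of_forall fun p ↦ ENNReal.mul_lt_top ENNReal.ofReal_lt_top ENNReal.ofReal_lt_top),
    ← integral_const_mul]
  congr 1
  ext p
  rw [ENNReal.toReal_mul, ENNReal.toReal_ofReal (exp_pos _).le,
    ENNReal.toReal_ofReal (exp_pos _).le, smul_eq_mul, ← mul_assoc, ← exp_add, ← exp_add,
    ← exp_add]
  ring_nf

lemma integrable_exp_mul_exp_gaussianReal_prod (a b : ℝ) :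
    Integrable (fun p : ℝ × ℝ ↦ exp (a * p.1) * exp (b * p.2))
      ((gaussianReal 0 1).prod (gaussianReal 0 1)) :=
  (integrable_exp_mul_gaussianReal a).mul_prod (integrable_exp_mul_gaussianReal b)

lemma map_sub_gaussianReal_prod (a b : ℝ) :
    ((gaussianReal a 1).prod (gaussianReal b 1)).map (fun p ↦ p.1 - p.2)
      = gaussianReal (a - b) 2 := by
  have hindep : IndepFun (fun p : ℝ × ℝ ↦ p.1) (fun p : ℝ × ℝ ↦ -p.2)
      ((gaussianReal a 1).prod (gaussianReal b 1)) :=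
    indepFun_prod (X := fun x : ℝ ↦ x) (Y := fun y : ℝ ↦ -y) measurable_id measurable_neg
  have hfst : ((gaussianReal a 1).prod (gaussianReal b 1)).map (fun p : ℝ × ℝ ↦ p.1)
      = gaussianReal a 1 := by simp
  have hsnd : ((gaussianReal a 1).prod (gaussianReal b 1)).map (fun p : ℝ × ℝ ↦ -p.2)
      = gaussianReal (-b) 1 := by
    have h := Measure.map_map (μ := (gaussianReal a 1).prod (gaussianReal b 1))
      (g := fun y : ℝ ↦ -y) measurable_neg measurable_snd
    rw [Measure.map_snd_prod, measure_univ, one_smul, gaussianReal_map_neg] at h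
    exact h.symm
  have h := gaussianReal_add_gaussianReal_of_indepFun hindep hfst hsnd
  rw [one_add_one_eq_two] at h
  simp only [sub_eq_add_neg]
  exact h

lemma gaussianReal_neg_two_Iic_zero (s : ℝ) :
    gaussianReal (-s) 2 (Set.Iic 0) = gaussianReal 0 1 (Set.Iic (s / √2)) := by
  have h : (gaussianReal 0 1).map (fun z ↦ √2 * z + -s) = gaussianReal (-s) 2 := by
    have h := Measure.map_map (μ := gaussianReal 0 1) (g := fun z : ℝ ↦ z + -s)
      (f := fun z : ℝ ↦ √2 * z) (by fun_prop) (by fun_prop)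
    rw [gaussianReal_map_const_mul, gaussianReal_map_add_const] at h
    refine h.symm.trans ?_
    congr 1
    · simp
    · ext; simp
  rw [← h, Measure.map_apply (by fun_prop) measurableSet_Iic]
  congr 1
  ext z
  simp [le_div_iff₀, mul_comm]

lemma gaussianReal_prod_real_le (a b : ℝ) :
    ((gaussianReal a 1).prod (gaussianReal b 1)).real {p | p.1 ≤ p.2}
      = (gaussianReal 0 1).real (Set.Iic ((b - a) / √2)) := by
  rw [measureReal_def, measureReal_def, ← gaussianReal_neg_two_Iic_zero, neg_sub,
    ← map_sub_gaussianReal_prod, Measure.map_apply (by fun_prop) measurableSet_Iic]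
  simp [Set.preimage]

lemma gaussianReal_prod_real_lt (a b : ℝ) :
    ((gaussianReal a 1).prod (gaussianReal b 1)).real {p | p.1 < p.2}
      = (gaussianReal 0 1).real (Set.Iic ((b - a) / √2)) := by
  have : NullSingletonClass (gaussianReal (a - b) 2) := nullSingletonClass_gaussianReal two_ne_zero
  rw [measureReal_def, measureReal_def, ← gaussianReal_neg_two_Iic_zero, neg_sub,
    ← measure_congr Iio_ae_eq_Iic,
    ← map_sub_gaussianReal_prod, Measure.map_apply (by fun_prop) measurableSet_Iio]
  simp [Set.preimage]

lemma gaussianReal_prod_real_ge (a b : ℝ) :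
    ((gaussianReal a 1).prod (gaussianReal b 1)).real {p | p.2 ≤ p.1}
      = (gaussianReal 0 1).real (Set.Iic ((a - b) / √2)) := by
  rw [← gaussianReal_prod_real_le, ← Measure.prod_swap, measureReal_def, measureReal_def,
    Measure.map_apply measurable_swap (measurableSet_le measurable_snd measurable_fst)]
  rfl

lemma exp_mul_exp_mul_max_exp (s x y : ℝ) (hs : 0 < s) :
    exp (-s ^ 2 / 2 + s * x) * exp (-s ^ 2 / 2 + s * y) *
        max (exp (-s ^ 2 / 2 + s * x)) (exp (-s ^ 2 / 2 + s * y))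
      = exp (-(3 * s ^ 2 / 2)) *
        (exp (2 * s * x) * exp (s * y) * {p : ℝ × ℝ | p.2 ≤ p.1}.indicator 1 (x, y)
          + exp (s * x) * exp (2 * s * y) * {p : ℝ × ℝ | p.1 < p.2}.indicator 1 (x, y)) := by
  rcases le_or_gt y x with h | h
  · have h' : exp (-s ^ 2 / 2 + s * y) ≤ exp (-s ^ 2 / 2 + s * x) := by gcongr
    simp only [max_eq_left h', Set.indicator, Set.mem_ofPred_eq, h, h.not_gt, if_true, if_false,
      Pi.one_apply, mul_one, mul_zero, add_zero, ← exp_add]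
    ring_nf
  · have h' : exp (-s ^ 2 / 2 + s * x) ≤ exp (-s ^ 2 / 2 + s * y) := by gcongr
    simp only [max_eq_right h', Set.indicator, Set.mem_ofPred_eq, h, h.not_ge, if_true, if_false,
      Pi.one_apply, mul_one, mul_zero, zero_add, ← exp_add]
    ring_nf

lemma integrable_exp_mul_exp_mul_indicator (a b : ℝ) {s : Set (ℝ × ℝ)} (hs : MeasurableSet s) :
    Integrable (fun p : ℝ × ℝ ↦ exp (a * p.1) * exp (b * p.2) * s.indicator 1 p)
      ((gaussianReal 0 1).prod (gaussianReal 0 1)) := by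
  refine ((integrable_exp_mul_exp_gaussianReal_prod a b).indicator hs).congr (.of_forall fun p ↦ ?_)
  by_cases hp : p ∈ s <;> simp [hp]

/-- Proposition 2 of the paper. Let `σ > 0` and let `Z, Z'` be independent
standard normal random variables. Set `W = exp(−σ²/2 + σZ)` and `W' = exp(−σ²/2 + σZ')`.
Then `E[W W' max{W, W'}] = 2 exp(σ²) Φ(σ/√2)`, where `Φ` is the standard normal CDF
(here expressed as the measure of `Iic` under `gaussianReal 0 1`). -/
theorem lognormal_triple_moment
    {Ω : Type*} [MeasurableSpace Ω] (Pr : Measure Ω) [IsProbabilityMeasure Pr]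
    (σ : ℝ) (hσ : 0 < σ) (Z Z' : Ω → ℝ)
    (hZmeas : Measurable Z) (hZ'meas : Measurable Z')
    (hZ : Measure.map Z Pr = gaussianReal 0 1)
    (hZ' : Measure.map Z' Pr = gaussianReal 0 1)
    (hindep : IndepFun Z Z' Pr) :
    ∫ ω, Real.exp (-σ ^ 2 / 2 + σ * Z ω) * Real.exp (-σ ^ 2 / 2 + σ * Z' ω) *
        max (Real.exp (-σ ^ 2 / 2 + σ * Z ω)) (Real.exp (-σ ^ 2 / 2 + σ * Z' ω)) ∂Pr
      = 2 * Real.exp (σ ^ 2) *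
        (gaussianReal 0 1 (Set.Iic (σ / Real.sqrt 2))).toReal := by
  have hlaw : Pr.map (fun ω ↦ (Z ω, Z' ω)) = (gaussianReal 0 1).prod (gaussianReal 0 1) := by
    rw [(indepFun_iff_map_prod_eq_prod_map_map hZmeas.aemeasurable hZ'meas.aemeasurable).1 hindep,
      hZ, hZ']
  have hge : MeasurableSet {p : ℝ × ℝ | p.2 ≤ p.1} := measurableSet_le measurable_snd measurable_fst
  have hlt : MeasurableSet {p : ℝ × ℝ | p.1 < p.2} := measurableSet_lt measurable_fst measurable_snd
  rw [← integral_map (φ := fun ω ↦ (Z ω, Z' ω))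
    (f := fun p : ℝ × ℝ ↦ exp (-σ ^ 2 / 2 + σ * p.1) * exp (-σ ^ 2 / 2 + σ * p.2) *
      max (exp (-σ ^ 2 / 2 + σ * p.1)) (exp (-σ ^ 2 / 2 + σ * p.2)))
    (by fun_prop) (by fun_prop), hlaw]
  simp_rw [exp_mul_exp_mul_max_exp σ _ _ hσ]
  rw [integral_const_mul, integral_add (integrable_exp_mul_exp_mul_indicator _ _ hge)
    (integrable_exp_mul_exp_mul_indicator _ _ hlt),
    integral_exp_mul_exp_mul_gaussianReal_prod, integral_exp_mul_exp_mul_gaussianReal_prod,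
    integral_indicator_one hge, integral_indicator_one hlt, gaussianReal_prod_real_ge,
    gaussianReal_prod_real_lt, ← measureReal_def, show 2 * σ - σ = σ by ring,
    add_comm (σ ^ 2) ((2 * σ) ^ 2), ← two_mul, mul_left_comm, ← mul_assoc (exp _), ← exp_add,
    ← mul_assoc]
  ring_nf
end

section
/- Let σ > 0, ρ ∈ [0,1), and set γ = ρ/(1+ρ). For any w > 0, let μ' = −σ²/2 + ρ·(log w + σ²/2) and σ'² = σ²(1−ρ²), and let Z be a standard normal random variable. Then E[exp((1−γ)·(μ' + σ'·Z))] ≥ w^γ. Equivalently, if (log W, log W') is bivariate normal with means (−σ²/2, −σ²/2), variances (σ², σ²) and correlation ρ, then E[W'^{1/2} b(W') | W = w] ≥ w^{1/2}/b(w) for all w > 0, with b(w) = w^{(1−ρ)/(2+2ρ)}; that is, Assumption 3 holds with this b and constant c_b = 1. -/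
open MeasureTheory ProbabilityTheory

/-- Proposition 3 of the paper. Let `σ > 0`, `ρ ∈ [0,1)` and set
`γ = ρ/(1+ρ)`. For any `w > 0`, let `μ' = −σ²/2 + ρ(log w + σ²/2)` and
`σ' = √(σ²(1−ρ²))`, and let `Z` be standard normal. Then
`E[exp((1−γ)(μ' + σ'Z))] ≥ w^γ`; i.e. if `(log W, log W')` is bivariate normal with means
`(−σ²/2, −σ²/2)`, variances `(σ², σ²)` and correlation `ρ`, then
`E[W'^{1/2} b(W') | W = w] ≥ w^{1/2}/b(w)` with `b(w) = w^{(1−ρ)/(2+2ρ)}`,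
so Assumption 3 holds with this `b` and `c_b = 1`. -/
theorem correlated_lognormal_assumption3
    (σ ρ w : ℝ) (hσ : 0 < σ) (hρ0 : 0 ≤ ρ) (hρ1 : ρ < 1) (hw : 0 < w) :
    w ^ (ρ / (1 + ρ))
      ≤ ∫ z, Real.exp ((1 - ρ / (1 + ρ)) *
          ((-σ ^ 2 / 2 + ρ * (Real.log w + σ ^ 2 / 2))
            + Real.sqrt (σ ^ 2 * (1 - ρ ^ 2)) * z)) ∂(gaussianReal 0 1) := by
  have hρ : 1 + ρ ≠ 0 := by positivity
  have hvar : Real.sqrt (σ ^ 2 * (1 - ρ ^ 2)) ^ 2 = σ ^ 2 * (1 - ρ ^ 2) :=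
    Real.sq_sqrt (mul_nonneg (sq_nonneg σ) (by nlinarith))
  have hmgf (t : ℝ) : ∫ z, Real.exp (t * z) ∂(gaussianReal 0 1) = Real.exp (t ^ 2 / 2) := by
    simpa [mgf] using congrFun (mgf_id_gaussianReal (μ := 0) (v := 1)) t
  simp_rw [mul_add (1 - ρ / (1 + ρ)), ← mul_assoc (1 - ρ / (1 + ρ)) (Real.sqrt _), Real.exp_add]
  rw [integral_const_mul, hmgf]
  simp only [← Real.exp_add]
  rw [Real.rpow_def_of_pos hw, mul_pow, hvar]
  apply le_of_eq
  congr 1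
  field_simp
  ring
end

section
/- Let a > 1, let U be uniformly distributed on [0, 2π), let Z be a standard normal random variable independent of U, and for w ≥ 0 define W' = (1+w)^{cos² U}·exp(Z²/(2a)) − 1. Then E[W'^{2/3}] ≥ c·w^{1/3}, where c = E[(exp(Z²/(2a)) − 1)^{2/3}] ∈ (0,∞). Consequently the correlated proposal W' satisfies Assumption 3 with b(w) = w^{1/6} and c_b = c. -/
open MeasureTheory ProbabilityTheory Real
open scoped ENNReal

theorem Function.Periodic.setLIntegral_Ico_add_right {f : ℝ → ℝ≥0∞} {T : ℝ}
    (hf : Function.Periodic f T) (hT : 0 < T) (c : ℝ) :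
    ∫⁻ x in Set.Ico 0 T, f (x + c) = ∫⁻ x in Set.Ico 0 T, f x := by
  have h := (measurePreserving_add_right volume c).setLIntegral_comp_preimage_emb
    (measurableEmbedding_addRight c) f (Set.Ioc c (c + T))
  have hpre : (fun x : ℝ => x + c) ⁻¹' Set.Ioc c (c + T) = Set.Ioc 0 T := by
    simp [Set.preimage_add_const_Ioc]
  rw [hpre] at h
  rw [setLIntegral_congr Ico_ae_eq_Ioc, h, setLIntegral_congr Ico_ae_eq_Ioc]
  have h0 := isAddFundamentalDomain_Ioc hT 0
  rw [zero_add] at h0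
  refine (isAddFundamentalDomain_Ioc hT c).setLIntegral_eq h0 f ?_
  rintro ⟨g, hg⟩ x
  obtain ⟨n, rfl⟩ := AddSubgroup.mem_zmultiples_iff.1 hg
  rw [AddSubgroup.vadd_def, vadd_eq_add, add_comm]
  exact hf.zsmul n x

theorem integrable_exp_sq_div_gaussianReal {a : ℝ} (ha : 1 < a) :
    Integrable (fun z => Real.exp (z ^ 2 / (2 * a))) (gaussianReal 0 1) := by
  rw [gaussianReal_of_var_ne_zero _ one_ne_zero,
    integrable_withDensity_iff (measurable_gaussianPDF 0 1)
      (ae_of_all _ fun _ => gaussianPDF_lt_top)]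
  have hb : 0 < 1 / 2 - 1 / (2 * a) := by
    rw [sub_pos]
    exact one_div_lt_one_div_of_lt two_pos (by linarith)
  refine ((integrable_exp_neg_mul_sq hb).const_mul (√(2 * π))⁻¹).congr (ae_of_all _ fun z => ?_)
  simp only [toReal_gaussianPDF, gaussianPDFReal, NNReal.coe_one, mul_one, sub_zero]
  rw [mul_left_comm, ← Real.exp_add]
  congr 2
  ring

theorem integrable_exp_sq_div_sub_one_rpow_gaussianReal {a : ℝ} (ha : 1 < a) :
    Integrable (fun z => (Real.exp (z ^ 2 / (2 * a)) - 1) ^ (2 / 3 : ℝ)) (gaussianReal 0 1) := by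
  refine (integrable_exp_sq_div_gaussianReal ha).mono'
    (by fun_prop : Measurable _).aestronglyMeasurable (ae_of_all _ fun z => ?_)
  have h1 : 1 ≤ Real.exp (z ^ 2 / (2 * a)) := Real.one_le_exp (by positivity)
  have h0 : 0 ≤ Real.exp (z ^ 2 / (2 * a)) - 1 := by linarith
  rw [Real.norm_of_nonneg (by positivity)]
  calc (Real.exp (z ^ 2 / (2 * a)) - 1) ^ (2 / 3 : ℝ)
      ≤ Real.exp (z ^ 2 / (2 * a)) ^ (2 / 3 : ℝ) :=
        Real.rpow_le_rpow h0 (by linarith) (by norm_num)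
    _ ≤ Real.exp (z ^ 2 / (2 * a)) ^ (1 : ℝ) := Real.rpow_le_rpow_of_exponent_le h1 (by norm_num)
    _ = _ := Real.rpow_one _

theorem integral_exp_sq_div_sub_one_rpow_gaussianReal_pos {a : ℝ} (ha : 1 < a) :
    0 < ∫ z, (Real.exp (z ^ 2 / (2 * a)) - 1) ^ (2 / 3 : ℝ) ∂(gaussianReal 0 1) := by
  have hexp : ∀ z : ℝ, 0 ≤ Real.exp (z ^ 2 / (2 * a)) - 1 := fun z =>
    sub_nonneg.2 (Real.one_le_exp (by positivity))
  rw [integral_pos_iff_support_of_nonneg (fun z => Real.rpow_nonneg (hexp z) _)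
    (integrable_exp_sq_div_sub_one_rpow_gaussianReal ha)]
  have hsub : ({0}ᶜ : Set ℝ) ⊆
      Function.support fun z : ℝ => (Real.exp (z ^ 2 / (2 * a)) - 1) ^ (2 / 3 : ℝ) := by
    intro z hz
    have hz : z ≠ 0 := hz
    exact (Real.rpow_pos_of_pos (sub_pos.2 (Real.one_lt_exp_iff.2 (by positivity))) _).ne'
  refine lt_of_lt_of_le ?_ (measure_mono hsub)
  have := nullSingletonClass_gaussianReal (μ := 0) (v := 1) one_ne_zero
  rw [prob_compl_eq_one_sub (measurableSet_singleton 0), measure_singleton]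
  simp

/-- The antithetic pair of proposals with exponents `s` and `1 - s` satisfies the bound on
average. -/
theorem two_mul_sub_one_rpow_mul_rpow_le {w x s : ℝ} (hw : 0 ≤ w) (hx : 1 ≤ x) (hs0 : 0 ≤ s)
    (hs1 : s ≤ 1) :
    2 * ((x - 1) ^ (2 / 3 : ℝ) * w ^ (1 / 3 : ℝ)) ≤
      ((1 + w) ^ s * x - 1) ^ (2 / 3 : ℝ) + ((1 + w) ^ (1 - s) * x - 1) ^ (2 / 3 : ℝ) := by
  have hy : 1 ≤ (1 + w) ^ s := Real.one_le_rpow (by linarith) hs0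
  have hy' : 1 ≤ (1 + w) ^ (1 - s) := Real.one_le_rpow (by linarith) (by linarith)
  have hyy : (1 + w) ^ s * (1 + w) ^ (1 - s) = 1 + w := by
    rw [← Real.rpow_add (by linarith), add_sub_cancel, Real.rpow_one]
  generalize (1 + w) ^ s = y at *
  generalize (1 + w) ^ (1 - s) = y' at *
  have hA : 0 ≤ y * x - 1 := by nlinarith
  have hB : 0 ≤ y' * x - 1 := by nlinarith
  have hx0 : 0 ≤ x - 1 := by linarith
  have hsum : y + y' ≤ 2 + w := by nlinarith
  have hprod : w * (x - 1) ^ 2 ≤ (y * x - 1) * (y' * x - 1) := by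
    have : (y * x - 1) * (y' * x - 1) = (1 + w) * x ^ 2 - (y + y') * x + 1 := by
      rw [← hyy]; ring
    rw [this]
    nlinarith [mul_le_mul_of_nonneg_right hsum (by linarith : 0 ≤ x), mul_nonneg hw hx0]
  have hsq : ((x - 1) ^ (2 / 3 : ℝ) * w ^ (1 / 3 : ℝ)) ^ 2 ≤
      (y * x - 1) ^ (2 / 3 : ℝ) * (y' * x - 1) ^ (2 / 3 : ℝ) := by
    rw [← Real.mul_rpow hA hB]
    refine le_trans (le_of_eq ?_) (Real.rpow_le_rpow (by positivity) hprod (by norm_num))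
    rw [Real.mul_rpow hw (by positivity), mul_pow, mul_comm, ← Real.rpow_mul_natCast hw,
      ← Real.rpow_natCast_mul hx0, ← Real.rpow_mul_natCast hx0]
    norm_num
  refine abs_le_of_sq_le_sq' ?_ (by positivity) |>.2
  nlinarith [sq_nonneg ((y * x - 1) ^ (2 / 3 : ℝ) - (y' * x - 1) ^ (2 / 3 : ℝ))]

/-- A uniform angle on `[0, T)` may be rotated, jointly with an independent variable. -/
theorem lintegral_add_const_of_periodic_of_indepFun {Ω : Type*} [MeasurableSpace Ω]
    {Pr : Measure Ω} [IsFiniteMeasure Pr] {U Z : Ω → ℝ} {T : ℝ} {k : ℝ≥0∞}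
    (hUmeas : Measurable U) (hZmeas : Measurable Z) (hT : 0 < T)
    (hU : Measure.map U Pr = k • volume.restrict (Set.Ico 0 T)) (hindep : IndepFun U Z Pr)
    {F : ℝ → ℝ → ℝ≥0∞} (hF : Measurable (Function.uncurry F))
    (hper : ∀ z, Function.Periodic (fun u => F u z) T) (c : ℝ) :
    ∫⁻ ω, F (U ω + c) (Z ω) ∂Pr = ∫⁻ ω, F (U ω) (Z ω) ∂Pr := by
  have key : ∀ G : ℝ → ℝ → ℝ≥0∞, Measurable (Function.uncurry G) →
      ∫⁻ ω, G (U ω) (Z ω) ∂Pr =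
        ∫⁻ z, (k * ∫⁻ u in Set.Ico 0 T, G u z) ∂(Measure.map Z Pr) := by
    intro G hG
    have h := lintegral_map (μ := Pr) hG (hUmeas.prodMk hZmeas)
    rw [hindep.map_prod_eq_prod_map_map hUmeas.aemeasurable hZmeas.aemeasurable,
      lintegral_prod_symm' _ hG, hU] at h
    simpa only [lintegral_smul_measure, Function.uncurry_apply_pair, smul_eq_mul] using h.symm
  rw [key F hF, key (fun u z => F (u + c) z)
    (hF.comp ((measurable_fst.add_const c).prodMk measurable_snd))]
  simp only [(hper _).setLIntegral_Ico_add_right hT]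

/-- Proposition 5 of the paper. Let `a > 1`, let `U` be uniform on
`[0,2π)`, let `Z` be standard normal independent of `U`, and for `w ≥ 0` define
`W' = (1+w)^{cos²U} exp(Z²/(2a)) − 1`. Then `E[W'^{2/3}] ≥ c w^{1/3}`, where
`c = E[(exp(Z²/(2a)) − 1)^{2/3}] ∈ (0,∞)`; i.e. the correlated proposal satisfies
Assumption 3 with `b(w) = w^{1/6}` and `c_b = c`. -/
theorem correlated_heavy_tail_assumption3
    {Ω : Type*} [MeasurableSpace Ω] (Pr : Measure Ω) [IsProbabilityMeasure Pr]
    (a w : ℝ) (ha : 1 < a) (hw : 0 ≤ w)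
    (U Z : Ω → ℝ) (hUmeas : Measurable U) (hZmeas : Measurable Z)
    (hU : Measure.map U Pr
      = (ENNReal.ofReal (2 * π))⁻¹ • (volume.restrict (Set.Ico 0 (2 * π))))
    (hZ : Measure.map Z Pr = gaussianReal 0 1)
    (hindep : IndepFun U Z Pr) :
    Integrable (fun ω => (Real.exp (Z ω ^ 2 / (2 * a)) - 1) ^ (2 / 3 : ℝ)) Pr ∧
    0 < ∫ ω, (Real.exp (Z ω ^ 2 / (2 * a)) - 1) ^ (2 / 3 : ℝ) ∂Pr ∧
    ENNReal.ofReal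
        ((∫ ω, (Real.exp (Z ω ^ 2 / (2 * a)) - 1) ^ (2 / 3 : ℝ) ∂Pr) * w ^ (1 / 3 : ℝ))
      ≤ ∫⁻ ω, ENNReal.ofReal
          (((1 + w) ^ (Real.cos (U ω) ^ 2) * Real.exp (Z ω ^ 2 / (2 * a)) - 1)
            ^ (2 / 3 : ℝ)) ∂Pr := by
  have hgm : AEStronglyMeasurable (fun z => (Real.exp (z ^ 2 / (2 * a)) - 1) ^ (2 / 3 : ℝ))
      (Measure.map Z Pr) := (by fun_prop : Measurable _).aestronglyMeasurable
  have hexp : ∀ z : ℝ, 1 ≤ Real.exp (z ^ 2 / (2 * a)) := fun z => Real.one_le_exp (by positivity)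
  have hint : Integrable (fun ω => (Real.exp (Z ω ^ 2 / (2 * a)) - 1) ^ (2 / 3 : ℝ)) Pr := by
    have h := integrable_exp_sq_div_sub_one_rpow_gaussianReal ha
    rw [← hZ] at h
    exact h.comp_measurable hZmeas
  refine ⟨hint, ?_, ?_⟩
  · rw [← integral_map hZmeas.aemeasurable hgm, hZ]
    exact integral_exp_sq_div_sub_one_rpow_gaussianReal_pos ha
  obtain ⟨F, hFdef⟩ : ∃ F : ℝ → ℝ → ℝ≥0∞, ∀ u z, F u z = ENNReal.ofReal
    (((1 + w) ^ (Real.cos u ^ 2) * Real.exp (z ^ 2 / (2 * a)) - 1) ^ (2 / 3 : ℝ)) :=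
    ⟨_, fun _ _ => rfl⟩
  have hF : Measurable (Function.uncurry F) := by
    unfold Function.uncurry
    simp only [hFdef]
    fun_prop
  have hper : ∀ z, Function.Periodic (fun u => F u z) (2 * π) := fun z u => by
    simp only [hFdef, Real.cos_add_two_pi]
  have hrot := lintegral_add_const_of_periodic_of_indepFun hUmeas hZmeas Real.two_pi_pos hU hindep
    hF hper (π / 2)
  have hFU : Measurable fun ω => F (U ω) (Z ω) := hF.comp (hUmeas.prodMk hZmeas)
  simp only [← hFdef]
  rw [← integral_mul_const, ofReal_integral_eq_lintegral_ofReal (hint.mul_const _)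
    (ae_of_all _ fun ω => mul_nonneg (Real.rpow_nonneg (sub_nonneg.2 (hexp _)) _)
      (Real.rpow_nonneg hw _))]
  refine (ENNReal.mul_le_mul_iff_right two_ne_zero ENNReal.ofNat_ne_top).1 ?_
  rw [two_mul (∫⁻ ω, F (U ω) (Z ω) ∂Pr)]
  nth_rw 2 [← hrot]
  rw [← lintegral_add_left hFU, ← lintegral_const_mul' _ _ ENNReal.ofNat_ne_top]
  refine lintegral_mono fun ω => ?_
  have hnonneg : ∀ s : ℝ, 0 ≤ s →
      0 ≤ ((1 + w) ^ s * Real.exp (Z ω ^ 2 / (2 * a)) - 1) ^ (2 / 3 : ℝ) := fun s hs =>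
    Real.rpow_nonneg (sub_nonneg.2 (one_le_mul_of_one_le_of_one_le
      (Real.one_le_rpow (by linarith) hs) (hexp _))) _
  simp only [hFdef, Real.cos_add_pi_div_two, neg_sq, Real.sin_sq]
  rw [← ENNReal.ofReal_add (hnonneg _ (sq_nonneg _)) (hnonneg _ (by linarith [Real.cos_sq_le_one (U ω)])),
    ← ENNReal.ofReal_ofNat, ← ENNReal.ofReal_mul zero_le_two]
  exact ENNReal.ofReal_le_ofReal (two_mul_sub_one_rpow_mul_rpow_le hw (hexp _) (sq_nonneg _)
    (Real.cos_sq_le_one _))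
end

section
/- Let σ > 0, let Z be a standard normal random variable, and set W' = exp(−σ²/2 + σZ). Then for every w > 0, E[min{1, W'/w}] = (1/w)·Φ(−σ/2 + (log w)/σ) + Φ(−σ/2 − (log w)/σ), where Φ is the cumulative distribution function of the standard normal distribution. -/
open MeasureTheory ProbabilityTheory

/-- Exponentially tilting a standard Gaussian by `σ` shifts its mean to `σ`. -/
lemma setIntegral_exp_mul_gaussianReal (σ : ℝ) {s : Set ℝ} (hs : MeasurableSet s) :
    ∫ x in s, Real.exp (-σ ^ 2 / 2 + σ * x) ∂gaussianReal 0 1 = (gaussianReal σ 1).real s := by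
  rw [← integral_indicator hs, integral_gaussianReal_eq_integral_smul one_ne_zero,
    measureReal_def, gaussianReal_apply_eq_integral σ one_ne_zero, ENNReal.toReal_ofReal
      (integral_nonneg fun x ↦ gaussianPDFReal_nonneg _ _ _), ← integral_indicator hs]
  congr 1 with x
  by_cases hx : x ∈ s
  · simp only [hx, Set.indicator_of_mem, gaussianPDFReal_def, smul_eq_mul, mul_assoc,
      ← Real.exp_add]
    congr 3
    simp only [NNReal.coe_one]
    ring
  · simp [hx]

lemma gaussianReal_Iic_sub (m a : ℝ) :
    (gaussianReal m 1).real (Set.Iic a) = (gaussianReal 0 1).real (Set.Iic (a - m)) := by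
  rw [← zero_add m, ← gaussianReal_map_add_const, map_measureReal_apply (by fun_prop)
    measurableSet_Iic]
  congr 1
  ext x
  simp [le_sub_iff_add_le]

lemma gaussianReal_Ioi_eq_Iic_neg (a : ℝ) :
    (gaussianReal 0 1).real (Set.Ioi a) = (gaussianReal 0 1).real (Set.Iic (-a)) := by
  have := nullSingletonClass_gaussianReal (μ := 0) (v := 1) one_ne_zero
  rw [← measureReal_congr Iio_ae_eq_Iic]
  nth_rw 2 [← neg_zero]
  rw [← gaussianReal_map_neg, map_measureReal_apply measurable_neg measurableSet_Iio]
  congr 1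
  ext x
  simp

/-- Let `σ > 0`, let `Z` be a standard normal random variable and set
`W' = exp(−σ²/2 + σZ)`. Then for every `w > 0`,
`E[min{1, W'/w}] = (1/w)Φ(−σ/2 + log w/σ) + Φ(−σ/2 − log w/σ)`,
where `Φ` is the standard normal CDF (expressed via `gaussianReal 0 1`). -/
theorem lognormal_acceptance_probability
    {Ω : Type*} [MeasurableSpace Ω] (Pr : Measure Ω) [IsProbabilityMeasure Pr]
    (σ : ℝ) (hσ : 0 < σ) (Z : Ω → ℝ) (hZmeas : Measurable Z)
    (hZ : Measure.map Z Pr = gaussianReal 0 1)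
    (w : ℝ) (hw : 0 < w) :
    ∫ ω, min 1 (Real.exp (-σ ^ 2 / 2 + σ * Z ω) / w) ∂Pr
      = (1 / w) * (gaussianReal 0 1 (Set.Iic (-σ / 2 + Real.log w / σ))).toReal
        + (gaussianReal 0 1 (Set.Iic (-σ / 2 - Real.log w / σ))).toReal := by
  have h_iff (x : ℝ) : x ≤ σ / 2 + Real.log w / σ ↔ Real.exp (-σ ^ 2 / 2 + σ * x) ≤ w := by
    rw [← Real.le_log_iff_exp_le hw, ← sub_le_iff_le_add', le_div_iff₀ hσ]
    constructor <;> intro h <;> linarith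
  have h_meas : Measurable fun x : ℝ ↦ min 1 (Real.exp (-σ ^ 2 / 2 + σ * x) / w) := by fun_prop
  have h_int : Integrable (fun x : ℝ ↦ min 1 (Real.exp (-σ ^ 2 / 2 + σ * x) / w))
      (gaussianReal 0 1) := by
    refine Integrable.of_bound h_meas.aestronglyMeasurable 1 (ae_of_all _ fun x ↦ ?_)
    rw [Real.norm_of_nonneg (by positivity)]
    exact min_le_left _ _
  rw [← integral_map (f := fun x : ℝ ↦ min 1 (Real.exp (-σ ^ 2 / 2 + σ * x) / w))
    hZmeas.aemeasurable h_meas.aestronglyMeasurable, hZ,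
    ← integral_add_compl (measurableSet_Iic (a := σ / 2 + Real.log w / σ)) h_int, Set.compl_Iic]
  simp only [← measureReal_def]
  congr 1
  · rw [setIntegral_congr_fun (g := fun x ↦ 1 / w * Real.exp (-σ ^ 2 / 2 + σ * x))
      measurableSet_Iic, integral_const_mul, setIntegral_exp_mul_gaussianReal σ measurableSet_Iic,
      gaussianReal_Iic_sub]
    · congr 3
      ring
    · intro x hx
      have := (div_le_one hw).2 ((h_iff x).1 hx)
      simp only [min_eq_right this]
      ring
  · rw [setIntegral_congr_fun (g := fun _ ↦ (1 : ℝ)) measurableSet_Ioi, setIntegral_const,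
      smul_eq_mul, mul_one, gaussianReal_Ioi_eq_Iic_neg]
    · congr 2
      ring
    · intro x hx
      have hlt : w < Real.exp (-σ ^ 2 / 2 + σ * x) := by
        simpa using (h_iff x).not.1 (not_le.2 hx)
      exact min_eq_left ((one_le_div hw).2 hlt.le)
end
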